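/- Let P be a random k×d matrix whose entries are i.i.d. centered Gaussians N(0, 1/k) (so that E[‖Px‖₂²] = ‖x‖₂² for all x), let x, y ∈ ℝ^d be fixed, let σ > 0, and let η, μ ∈ ℝ^k have their 2k coordinates i.i.d. distributed as N(0,σ²), independently of P. Define Ê_iid := ‖(Px+η) − (Py+μ)‖₂² − 2k·σ². Then (1) E[Ê_iid] = ‖x−y‖₂², and (2) Var[Ê_iid] = (2/k)·‖x−y‖₂⁴ + 8·σ²·‖x−y‖₂² + 8·σ⁴·k. -/

import Mathlib

open MeasureTheory ProbabilityTheory Finset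
open scoped ENNReal NNReal

/-- The fourth moment of a centered real Gaussian distribution is three times the square of its
variance. -/
lemma integral_pow_four_gaussianReal (v : ℝ≥0) :
    ∫ x, x ^ 4 ∂gaussianReal 0 v = 3 * (v : ℝ) ^ 2 := by
  have hmoment : ∫ x, x ^ 4 ∂gaussianReal 0 v
      = iteratedDeriv 4 (mgf (fun x ↦ x) (gaussianReal 0 v)) 0 := by
    rw [iteratedDeriv_mgf_zero] <;> simp
  have hexp (t : ℝ) : HasDerivAt (fun t : ℝ ↦ Real.exp (v * t ^ 2 / 2))
      (Real.exp (v * t ^ 2 / 2) * (v * t)) t := by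
    convert ((hasDerivAt_pow 2 t).const_mul (v : ℝ)).div_const 2 |>.exp using 1
    push_cast
    ring
  have hstep (p : Polynomial ℝ) : deriv (fun t : ℝ ↦ p.eval t * Real.exp (v * t ^ 2 / 2))
      = fun t ↦ (p.derivative + .C (v : ℝ) * .X * p).eval t * Real.exp (v * t ^ 2 / 2) := by
    ext t
    refine ((p.hasDerivAt t).mul (hexp t)).deriv.trans ?_
    simp only [Polynomial.eval_add, Polynomial.eval_mul, Polynomial.eval_C, Polynomial.eval_X]
    ring
  have hmgf : mgf (fun x ↦ x) (gaussianReal 0 v)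
      = fun t ↦ (1 : Polynomial ℝ).eval t * Real.exp (v * t ^ 2 / 2) := by
    rw [mgf_fun_id_gaussianReal]
    simp
  rw [hmoment, hmgf, iteratedDeriv_eq_iterate]
  simp only [Function.iterate_succ, Function.iterate_zero, Function.comp_apply, id, hstep]
  simp
  ring

section Gaussian

variable {Ω : Type*} [MeasurableSpace Ω] {Pr : Measure Ω}

/-- The second moment of a centered random variable is its variance. -/
lemma integral_sq_eq_variance {X : Ω → ℝ} (hX : AEMeasurable X Pr) (hmean : ∫ ω, X ω ∂Pr = 0) :
    ∫ ω, X ω ^ 2 ∂Pr = Var[X; Pr] := by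
  simp [variance_eq_integral hX, hmean]

/-- The square of a real Gaussian variable is square integrable. -/
lemma ProbabilityTheory.HasGaussianLaw.memLp_two_sq {X : Ω → ℝ} (hX : HasGaussianLaw X Pr) :
    MemLp (fun ω ↦ X ω ^ 2) 2 Pr := by
  have := hX.aemeasurable
  rw [memLp_two_iff_integrable_sq (by fun_prop)]
  simpa [← pow_mul, Even.pow_abs (show Even 4 by decide)] using
    (hX.memLp (p := (4 : ℕ)) (by simp)).integrable_norm_pow (by simp)

/-- The variance of the square of a centered Gaussian variable. -/
lemma ProbabilityTheory.HasGaussianLaw.variance_sq {X : Ω → ℝ} (hX : HasGaussianLaw X Pr)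
    (hmean : ∫ ω, X ω ∂Pr = 0) :
    Var[fun ω ↦ X ω ^ 2; Pr] = 2 * Var[X; Pr] ^ 2 := by
  have := hX.isProbabilityMeasure
  have hfour : ∫ ω, X ω ^ 4 ∂Pr = 3 * Var[X; Pr] ^ 2 := by
    have hlaw := hX.map_eq_gaussianReal
    rw [hmean] at hlaw
    rw [← integral_map (f := fun x : ℝ ↦ x ^ 4) hX.aemeasurable (by fun_prop), hlaw,
      integral_pow_four_gaussianReal, Real.coe_toNNReal _ (variance_nonneg _ _)]
  rw [variance_eq_sub hX.memLp_two_sq, integral_sq_eq_variance hX.aemeasurable hmean]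
  simp only [Pi.pow_apply, ← pow_mul]
  rw [hfour]
  ring

/-- The variance of the squared norm of a centered Gaussian vector with uncorrelated
coordinates. -/
lemma ProbabilityTheory.HasGaussianLaw.variance_sum_sq {ι : Type*} [Fintype ι] {X : ι → Ω → ℝ}
    (hX : HasGaussianLaw (fun ω ↦ (X · ω)) Pr) (hmean : ∀ i, ∫ ω, X i ω ∂Pr = 0)
    (hcov : ∀ i j, i ≠ j → cov[X i, X j; Pr] = 0) :
    Var[fun ω ↦ ∑ i, X i ω ^ 2; Pr] = ∑ i, 2 * Var[X i; Pr] ^ 2 := by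
  have hindep := hX.iIndepFun_of_covariance_eq_zero hcov
  have hsum := IndepFun.variance_sum (μ := Pr) (X := fun i ω ↦ X i ω ^ 2) (s := univ)
    (fun i _ ↦ (hX.eval i).memLp_two_sq)
    fun i _ j _ hij ↦ (hindep.indepFun hij).comp (φ := (· ^ 2)) (ψ := (· ^ 2))
      (by fun_prop) (by fun_prop)
  rw [sum_fn] at hsum
  simp only [hsum, fun i ↦ (hX.eval i).variance_sq (hmean i)]

section Pi

variable {ι : Type*} [Fintype ι] {X : Ω → ι → ℝ} {v : ℝ≥0}

lemma map_eval_of_map_eq_pi_gaussianReal (hX : Measurable X)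
    (hlaw : Pr.map X = Measure.pi fun _ ↦ gaussianReal 0 v) (a : ι) :
    Pr.map (fun ω ↦ X ω a) = gaussianReal 0 v := by
  rw [← (measurePreserving_eval (fun _ : ι ↦ gaussianReal 0 v) a).map_eq, ← hlaw,
    Measure.map_map (by fun_prop) hX]
  rfl

lemma integral_eval_of_map_eq_pi_gaussianReal (hX : Measurable X)
    (hlaw : Pr.map X = Measure.pi fun _ ↦ gaussianReal 0 v) (a : ι) :
    ∫ ω, X ω a ∂Pr = 0 := by
  rw [← integral_map (f := fun x : ℝ ↦ x) (φ := fun ω ↦ X ω a) (by fun_prop) (by fun_prop),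
    map_eval_of_map_eq_pi_gaussianReal hX hlaw, integral_id_gaussianReal]

variable [IsProbabilityMeasure Pr]

lemma iIndepFun_eval_of_map_eq_pi_gaussianReal (hX : Measurable X)
    (hlaw : Pr.map X = Measure.pi fun _ ↦ gaussianReal 0 v) :
    iIndepFun (fun a ω ↦ X ω a) Pr := by
  rw [iIndepFun_iff_map_fun_eq_pi_map (by fun_prop)]
  simpa only [map_eval_of_map_eq_pi_gaussianReal hX hlaw] using hlaw

lemma hasGaussianLaw_of_map_eq_pi_gaussianReal (hX : Measurable X)
    (hlaw : Pr.map X = Measure.pi fun _ ↦ gaussianReal 0 v) : HasGaussianLaw X Pr :=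
  (iIndepFun_eval_of_map_eq_pi_gaussianReal hX hlaw).hasGaussianLaw fun a ↦
    ⟨by rw [map_eval_of_map_eq_pi_gaussianReal hX hlaw]; infer_instance⟩

lemma memLp_two_eval_of_map_eq_pi_gaussianReal (hX : Measurable X)
    (hlaw : Pr.map X = Measure.pi fun _ ↦ gaussianReal 0 v) (a : ι) :
    MemLp (fun ω ↦ X ω a) 2 Pr :=
  (HasGaussianLaw.eval (X := fun a ω ↦ X ω a)
    (hasGaussianLaw_of_map_eq_pi_gaussianReal hX hlaw) a).memLp_two

/-- Independent centered Gaussian coordinates of variance `v` have covariance matrix `v • 1`. -/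
lemma covariance_eval_of_map_eq_pi_gaussianReal [DecidableEq ι] (hX : Measurable X)
    (hlaw : Pr.map X = Measure.pi fun _ ↦ gaussianReal 0 v) (a b : ι) :
    cov[fun ω ↦ X ω a, fun ω ↦ X ω b; Pr] = if a = b then (v : ℝ) else 0 := by
  split_ifs with h
  · subst h
    rw [covariance_self (by fun_prop), ← variance_fun_id_gaussianReal (μ := 0) (v := v),
      ← map_eval_of_map_eq_pi_gaussianReal hX hlaw a,
      variance_map (by fun_prop) (by fun_prop)]
    rfl
  · exact ((iIndepFun_eval_of_map_eq_pi_gaussianReal hX hlaw).indepFun h).covariance_eq_zero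
      (memLp_two_eval_of_map_eq_pi_gaussianReal hX hlaw a)
      (memLp_two_eval_of_map_eq_pi_gaussianReal hX hlaw b)

/-- The covariance of two linear combinations of independent centered Gaussian coordinates. -/
lemma covariance_sum_mul_of_map_eq_pi_gaussianReal (hX : Measurable X)
    (hlaw : Pr.map X = Measure.pi fun _ ↦ gaussianReal 0 v) (c c' : ι → ℝ) :
    cov[fun ω ↦ ∑ a, X ω a * c a, fun ω ↦ ∑ a, X ω a * c' a; Pr]
      = v * ∑ a, c a * c' a := by
  classical
  have hL := memLp_two_eval_of_map_eq_pi_gaussianReal hX hlaw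
  rw [covariance_fun_sum_fun_sum (fun a ↦ (hL a).mul_const (c a))
    (fun a ↦ (hL a).mul_const (c' a)), mul_sum]
  simp only [covariance_mul_const_left, covariance_mul_const_right,
    covariance_eval_of_map_eq_pi_gaussianReal hX hlaw]
  refine sum_congr rfl fun a _ ↦ ?_
  simp
  ring

lemma integral_sum_mul_of_map_eq_pi_gaussianReal (hX : Measurable X)
    (hlaw : Pr.map X = Measure.pi fun _ ↦ gaussianReal 0 v) (c : ι → ℝ) :
    ∫ ω, ∑ a, X ω a * c a ∂Pr = 0 := by
  have hL := memLp_two_eval_of_map_eq_pi_gaussianReal hX hlaw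
  rw [integral_finsetSum _ fun a _ ↦ ((hL a).integrable (by simp)).mul_const _]
  simp [integral_mul_const, integral_eval_of_map_eq_pi_gaussianReal hX hlaw]

end Pi

/-- A family of linear combinations of two independent families of Gaussian variables is jointly
Gaussian. -/
lemma hasGaussianLaw_sum_mul_add_sum_mul {ι κ l : Type*} [Fintype ι] [Fintype κ] [Fintype l]
    {X : Ω → ι → ℝ} {Y : Ω → κ → ℝ} (hX : HasGaussianLaw X Pr) (hY : HasGaussianLaw Y Pr)
    (hXY : IndepFun X Y Pr) (c : l → ι → ℝ) (e : l → κ → ℝ) :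
    HasGaussianLaw (fun ω i ↦ ∑ a, X ω a * c i a + ∑ b, Y ω b * e i b) Pr := by
  let L : (ι → ℝ) × (κ → ℝ) →ₗ[ℝ] l → ℝ :=
    { toFun p i := ∑ a, p.1 a * c i a + ∑ b, p.2 b * e i b
      map_add' p q := by
        ext i
        simp only [Prod.fst_add, Prod.snd_add, Pi.add_apply, add_mul, sum_add_distrib]
        ring
      map_smul' r p := by
        ext i
        simp only [Prod.smul_fst, Prod.smul_snd, Pi.smul_apply, smul_eq_mul, mul_assoc, ← mul_sum,
          RingHom.id_apply, mul_add] }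
  exact (hXY.hasGaussianLaw hX hY).map_fun L.toContinuousLinearMap

/-- The covariance of two linear combinations of independent centered Gaussian variables, split
into two independent groups of respective variances `v` and `w`. -/
lemma covariance_sum_mul_add_sum_mul [IsProbabilityMeasure Pr] {ι κ : Type*}
    [Fintype ι] [Fintype κ] {X : Ω → ι → ℝ} {Y : Ω → κ → ℝ} {v w : ℝ≥0}
    (hX : Measurable X) (hXlaw : Pr.map X = Measure.pi fun _ ↦ gaussianReal 0 v)
    (hY : Measurable Y) (hYlaw : Pr.map Y = Measure.pi fun _ ↦ gaussianReal 0 w)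
    (hXY : IndepFun X Y Pr) (c c' : ι → ℝ) (e e' : κ → ℝ) :
    cov[fun ω ↦ ∑ a, X ω a * c a + ∑ b, Y ω b * e b,
        fun ω ↦ ∑ a, X ω a * c' a + ∑ b, Y ω b * e' b; Pr]
      = v * ∑ a, c a * c' a + w * ∑ b, e b * e' b := by
  have hLX (c : ι → ℝ) : MemLp (fun ω ↦ ∑ a, X ω a * c a) 2 Pr :=
    memLp_finsetSum _ fun a _ ↦
      (memLp_two_eval_of_map_eq_pi_gaussianReal hX hXlaw a).mul_const (c a)
  have hLY (e : κ → ℝ) : MemLp (fun ω ↦ ∑ b, Y ω b * e b) 2 Pr :=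
    memLp_finsetSum _ fun b _ ↦
      (memLp_two_eval_of_map_eq_pi_gaussianReal hY hYlaw b).mul_const (e b)
  have hcross (c : ι → ℝ) (e : κ → ℝ) :
      cov[fun ω ↦ ∑ a, X ω a * c a, fun ω ↦ ∑ b, Y ω b * e b; Pr] = 0 :=
    (hXY.comp (φ := fun x : ι → ℝ ↦ ∑ a, x a * c a) (ψ := fun y : κ → ℝ ↦ ∑ b, y b * e b)
      (by fun_prop) (by fun_prop)).covariance_eq_zero (hLX c) (hLY e)
  refine (covariance_add_left (hLX c) (hLY e) ((hLX c').add (hLY e'))).trans ?_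
  rw [covariance_add_right (hLX c) (hLX c') (hLY e'),
    covariance_add_right (hLY e) (hLX c') (hLY e'), hcross,
    covariance_comm (fun ω ↦ ∑ b, Y ω b * e b) (fun ω ↦ ∑ a, X ω a * c' a), hcross,
    covariance_sum_mul_of_map_eq_pi_gaussianReal hX hXlaw,
    covariance_sum_mul_of_map_eq_pi_gaussianReal hY hYlaw]
  ring

end Gaussian

/-- Let `P` be a random `k × d` matrix whose entries are i.i.d. centered
Gaussians `N(0, 1/k)`, let `x, y ∈ ℝ^d` be fixed, let `σ > 0`, and let
`η = N ∘ Sum.inl`, `μ = N ∘ Sum.inr` have their `2k` coordinates i.i.d. `N(0, σ²)`,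
independently of `P`.  Define `Ê_iid = ‖(Px+η) - (Py+μ)‖₂² - 2 k σ²`.  Then
(1) `E[Ê_iid] = ‖x-y‖₂²`, and
(2) `Var[Ê_iid] = (2/k) ‖x-y‖₂⁴ + 8 σ² ‖x-y‖₂² + 8 σ⁴ k`. -/
theorem iid_gaussian_projection_estimator
    {Ω : Type*} [MeasurableSpace Ω] (Pr : Measure Ω) [IsProbabilityMeasure Pr]
    (k d : ℕ) (hk : 0 < k)
    (P : Ω → (Fin k × Fin d) → ℝ) (hPmeas : Measurable P)
    (hPlaw : Measure.map P Pr = Measure.pi (fun _ => gaussianReal 0 ((k : ℝ≥0))⁻¹))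
    (σ : ℝ) (hσ : 0 < σ)
    (N : Ω → (Fin k ⊕ Fin k) → ℝ) (hNmeas : Measurable N)
    (hNlaw : Measure.map N Pr = Measure.pi (fun _ => gaussianReal 0 (σ ^ 2).toNNReal))
    (hindep : IndepFun P N Pr)
    (x y : Fin d → ℝ) :
    (∫ ω, (∑ i, ((∑ j, P ω (i, j) * x j) + N ω (Sum.inl i)
          - ((∑ j, P ω (i, j) * y j) + N ω (Sum.inr i))) ^ 2)
        - 2 * (k : ℝ) * σ ^ 2 ∂Pr) = ∑ j, (x j - y j) ^ 2
    ∧ variance (fun ω =>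
        (∑ i, ((∑ j, P ω (i, j) * x j) + N ω (Sum.inl i)
          - ((∑ j, P ω (i, j) * y j) + N ω (Sum.inr i))) ^ 2)
        - 2 * (k : ℝ) * σ ^ 2) Pr
      = (2 / (k : ℝ)) * (∑ j, (x j - y j) ^ 2) ^ 2
        + 8 * σ ^ 2 * (∑ j, (x j - y j) ^ 2)
        + 8 * σ ^ 4 * (k : ℝ) := by
  classical
  let c : Fin k → Fin k × Fin d → ℝ := fun i a ↦ if a.1 = i then x a.2 - y a.2 else 0
  let e : Fin k → Fin k ⊕ Fin k → ℝ := fun i ↦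
    Sum.elim (fun j ↦ if j = i then 1 else 0) (fun j ↦ if j = i then -1 else 0)
  let W : Fin k → Ω → ℝ := fun i ω ↦ ∑ a, P ω a * c i a + ∑ b, N ω b * e i b
  set S : ℝ := ∑ j, (x j - y j) ^ 2 with hS
  have hk' : (k : ℝ) ≠ 0 := by positivity
  have hW (i : Fin k) (ω : Ω) : (∑ j, P ω (i, j) * x j) + N ω (Sum.inl i)
      - ((∑ j, P ω (i, j) * y j) + N ω (Sum.inr i)) = W i ω := by
    simp only [W, c, e, Fintype.sum_prod_type_right, Fintype.sum_sum_type, Sum.elim_inl,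
      Sum.elim_inr, mul_ite, mul_zero, mul_one, mul_neg, sum_ite_eq', mem_univ, if_true, mul_sub,
      sum_sub_distrib]
    ring
  have hGauss : HasGaussianLaw (fun ω ↦ (W · ω)) Pr :=
    hasGaussianLaw_sum_mul_add_sum_mul (hasGaussianLaw_of_map_eq_pi_gaussianReal hPmeas hPlaw)
      (hasGaussianLaw_of_map_eq_pi_gaussianReal hNmeas hNlaw) hindep c e
  have hmean (i : Fin k) : ∫ ω, W i ω ∂Pr = 0 := by
    rw [integral_add, integral_sum_mul_of_map_eq_pi_gaussianReal hPmeas hPlaw,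
      integral_sum_mul_of_map_eq_pi_gaussianReal hNmeas hNlaw, add_zero]
    · exact integrable_finsetSum _ fun a _ ↦ ((memLp_two_eval_of_map_eq_pi_gaussianReal
        hPmeas hPlaw a).integrable (by simp)).mul_const _
    · exact integrable_finsetSum _ fun a _ ↦ ((memLp_two_eval_of_map_eq_pi_gaussianReal
        hNmeas hNlaw a).integrable (by simp)).mul_const _
  have hcov (i j : Fin k) : cov[W i, W j; Pr] = if i = j then S / k + 2 * σ ^ 2 else 0 := by
    rw [covariance_sum_mul_add_sum_mul hPmeas hPlaw hNmeas hNlaw hindep]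
    simp only [c, e, Fintype.sum_prod_type_right, Fintype.sum_sum_type, Sum.elim_inl,
      Sum.elim_inr, ite_mul, zero_mul, sum_ite_eq', mem_univ, if_true]
    split_ifs with h
    · rw [Real.coe_toNNReal _ (sq_nonneg σ)]
      simp only [← sq, ← hS, NNReal.coe_inv, NNReal.coe_natCast]
      ring
    · simp
  have hvar (i : Fin k) : Var[W i; Pr] = S / k + 2 * σ ^ 2 := by
    rw [← covariance_self (hGauss.eval i).aemeasurable, hcov, if_pos rfl]
  have hLp (i : Fin k) := (hGauss.eval i).memLp_two_sq
  simp only [hW]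
  constructor
  · rw [integral_sub (integrable_finsetSum _ fun i _ ↦ (hLp i).integrable (by simp))
      (integrable_const _), integral_finsetSum _ fun i _ ↦ (hLp i).integrable (by simp)]
    simp only [integral_sq_eq_variance (hGauss.eval _).aemeasurable (hmean _), hvar]
    simp
    field_simp
    ring
  · rw [variance_sub_const (memLp_finsetSum _ fun i _ ↦ hLp i).aestronglyMeasurable,
      hGauss.variance_sum_sq hmean fun i j hij ↦ by rw [hcov, if_neg hij]]
    simp only [hvar]
    simp
    field_simp
    ring
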